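/- Let M be a Hopf bimodule over H, let I be an H-bimodule, and let φ : M → I be an injective morphism of H-bimodules. Then the map ψ : M → H ⊗̄ I ⊗̄ H defined by ψ(m) = m_{(-1)} ⊗ φ(m_{(0)}) ⊗ m_{(1)} is an injective morphism of Hopf bimodules, and (ε ⊗ id ⊗ ε) ∘ ψ = φ. -/

import Mathlib

set_option linter.unusedSectionVars false

open TensorProduct

universe u

section Core

variable (k : Type u) [Field k] (H : Type u) [Ring H] [HopfAlgebra k H]

/-- The data of a Hopf bimodule structure on a `k`-vector space `M`:
two actions and two coactions of the Hopf algebra `H`. -/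
structure HopfBimoduleData (M : Type u) [AddCommGroup M] [Module k M] : Type u where
  actL : H ⊗[k] M →ₗ[k] M
  actR : M ⊗[k] H →ₗ[k] M
  coactL : M →ₗ[k] H ⊗[k] M
  coactR : M →ₗ[k] M ⊗[k] H

variable {k H}
variable {M N P Q : Type u} [AddCommGroup M] [Module k M] [AddCommGroup N] [Module k N]
  [AddCommGroup P] [Module k P] [AddCommGroup Q] [Module k Q]

/-- Diagonal left action of `H` on a tensor product `P ⊗ Q`, given left actions on `P` and `Q`:
`h · (p ⊗ q) = h⁽¹⁾ p ⊗ h⁽²⁾ q`. -/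
noncomputable def diagActL (aP : H ⊗[k] P →ₗ[k] P) (aQ : H ⊗[k] Q →ₗ[k] Q) :
    H ⊗[k] (P ⊗[k] Q) →ₗ[k] P ⊗[k] Q :=
  (TensorProduct.map aP aQ) ∘ₗ (TensorProduct.tensorTensorTensorComm k H H P Q).toLinearMap ∘ₗ
    (LinearMap.rTensor (P ⊗[k] Q) (Coalgebra.comul (R := k) (A := H)))

/-- Diagonal right action of `H` on a tensor product `P ⊗ Q`:
`(p ⊗ q) · h = p h⁽¹⁾ ⊗ q h⁽²⁾`. -/
noncomputable def diagActR (aP : P ⊗[k] H →ₗ[k] P) (aQ : Q ⊗[k] H →ₗ[k] Q) :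
    (P ⊗[k] Q) ⊗[k] H →ₗ[k] P ⊗[k] Q :=
  (TensorProduct.map aP aQ) ∘ₗ (TensorProduct.tensorTensorTensorComm k P Q H H).toLinearMap ∘ₗ
    (LinearMap.lTensor (P ⊗[k] Q) (Coalgebra.comul (R := k) (A := H)))

/-- Codiagonal left coaction on `P ⊗ Q`: `p ⊗ q ↦ p₍₋₁₎ q₍₋₁₎ ⊗ p₍₀₎ ⊗ q₍₀₎`. -/
noncomputable def codiagCoactL (cP : P →ₗ[k] H ⊗[k] P) (cQ : Q →ₗ[k] H ⊗[k] Q) :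
    P ⊗[k] Q →ₗ[k] H ⊗[k] (P ⊗[k] Q) :=
  (LinearMap.rTensor (P ⊗[k] Q) (LinearMap.mul' k H)) ∘ₗ
    (TensorProduct.tensorTensorTensorComm k H P H Q).toLinearMap ∘ₗ (TensorProduct.map cP cQ)

/-- Codiagonal right coaction on `P ⊗ Q`: `p ⊗ q ↦ p₍₀₎ ⊗ q₍₀₎ ⊗ p₍₁₎ q₍₁₎`. -/
noncomputable def codiagCoactR (cP : P →ₗ[k] P ⊗[k] H) (cQ : Q →ₗ[k] Q ⊗[k] H) :
    P ⊗[k] Q →ₗ[k] (P ⊗[k] Q) ⊗[k] H :=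
  (LinearMap.lTensor (P ⊗[k] Q) (LinearMap.mul' k H)) ∘ₗ
    (TensorProduct.tensorTensorTensorComm k P H Q H).toLinearMap ∘ₗ (TensorProduct.map cP cQ)

namespace HopfBimoduleData

/-- The Hopf bimodule `M b⊗ N`: regular actions, codiagonal coactions. -/
noncomputable def botimes (dM : HopfBimoduleData k H M) (dN : HopfBimoduleData k H N) :
    HopfBimoduleData k H (M ⊗[k] N) where
  actL := LinearMap.rTensor N dM.actL ∘ₗ (TensorProduct.assoc k H M N).symm.toLinearMap
  actR := LinearMap.lTensor M dN.actR ∘ₗ (TensorProduct.assoc k M N H).toLinearMap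
  coactL := codiagCoactL dM.coactL dN.coactL
  coactR := codiagCoactR dM.coactR dN.coactR

/-- The Hopf bimodule `M ⊗̄ N`: diagonal actions, regular coactions. -/
noncomputable def obar (dM : HopfBimoduleData k H M) (dN : HopfBimoduleData k H N) :
    HopfBimoduleData k H (M ⊗[k] N) where
  actL := diagActL dM.actL dN.actL
  actR := diagActR dM.actR dN.actR
  coactL := (TensorProduct.assoc k H M N).toLinearMap ∘ₗ LinearMap.rTensor N dM.coactL
  coactR := (TensorProduct.assoc k M N H).symm.toLinearMap ∘ₗ LinearMap.lTensor M dN.coactR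

end HopfBimoduleData

variable (k H) in
/-- `H` as the regular Hopf bimodule over itself. -/
noncomputable def regularHB : HopfBimoduleData k H H :=
  ⟨LinearMap.mul' k H, LinearMap.mul' k H,
    Coalgebra.comul (R := k) (A := H), Coalgebra.comul (R := k) (A := H)⟩

/-- `aL`, `aR` form an `H`-bimodule structure (compatible with the `k`-structure). -/
structure IsBimodule (aL : H ⊗[k] M →ₗ[k] M) (aR : M ⊗[k] H →ₗ[k] M) : Prop where
  one_actL : ∀ m : M, aL ((1 : H) ⊗ₜ[k] m) = m
  mul_actL : ∀ (a b : H) (m : M), aL ((a * b) ⊗ₜ[k] m) = aL (a ⊗ₜ[k] aL (b ⊗ₜ[k] m))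
  actR_one : ∀ m : M, aR (m ⊗ₜ[k] (1 : H)) = m
  actR_mul : ∀ (m : M) (a b : H), aR (m ⊗ₜ[k] (a * b)) = aR (aR (m ⊗ₜ[k] a) ⊗ₜ[k] b)
  middle : ∀ (a : H) (m : M) (b : H),
    aR (aL (a ⊗ₜ[k] m) ⊗ₜ[k] b) = aL (a ⊗ₜ[k] aR (m ⊗ₜ[k] b))

/-- `cL`, `cR` form an `H`-bicomodule structure on `M`. -/
structure IsBicomodule (cL : M →ₗ[k] H ⊗[k] M) (cR : M →ₗ[k] M ⊗[k] H) : Prop where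
  coassocL : (LinearMap.lTensor H cL) ∘ₗ cL =
    (TensorProduct.assoc k H H M).toLinearMap ∘ₗ
      (LinearMap.rTensor M (Coalgebra.comul (R := k) (A := H))) ∘ₗ cL
  counitL : (TensorProduct.lid k M).toLinearMap ∘ₗ
      (LinearMap.rTensor M (Coalgebra.counit (R := k) (A := H))) ∘ₗ cL = LinearMap.id
  coassocR : (LinearMap.rTensor H cR) ∘ₗ cR =
    (TensorProduct.assoc k M H H).symm.toLinearMap ∘ₗ
      (LinearMap.lTensor M (Coalgebra.comul (R := k) (A := H))) ∘ₗ cR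
  counitR : (TensorProduct.rid k M).toLinearMap ∘ₗ
      (LinearMap.lTensor M (Coalgebra.counit (R := k) (A := H))) ∘ₗ cR = LinearMap.id
  bicomod : (LinearMap.lTensor H cR) ∘ₗ cL =
    (TensorProduct.assoc k H M H).toLinearMap ∘ₗ (LinearMap.rTensor H cL) ∘ₗ cR

/-- The axioms making the data `d` an actual Hopf bimodule over `H`: `M` is an
`H`-bimodule, an `H`-bicomodule, and both coactions are morphisms of `H`-bimodules
(`H ⊗ M` and `M ⊗ H` carrying the diagonal actions). -/
structure HopfBimoduleData.IsHopfBimodule (d : HopfBimoduleData k H M) : Prop where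
  bimodule : IsBimodule d.actL d.actR
  bicomodule : IsBicomodule d.coactL d.coactR
  coactL_actL : d.coactL ∘ₗ d.actL =
    (diagActL (LinearMap.mul' k H) d.actL) ∘ₗ (LinearMap.lTensor H d.coactL)
  coactL_actR : d.coactL ∘ₗ d.actR =
    (diagActR (LinearMap.mul' k H) d.actR) ∘ₗ (LinearMap.rTensor H d.coactL)
  coactR_actL : d.coactR ∘ₗ d.actL =
    (diagActL d.actL (LinearMap.mul' k H)) ∘ₗ (LinearMap.lTensor H d.coactR)
  coactR_actR : d.coactR ∘ₗ d.actR =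
    (diagActR d.actR (LinearMap.mul' k H)) ∘ₗ (LinearMap.rTensor H d.coactR)

/-- `f : M → N` is a morphism of `H`-bimodules. -/
structure IsBimoduleHom (aLM : H ⊗[k] M →ₗ[k] M) (aRM : M ⊗[k] H →ₗ[k] M)
    (aLN : H ⊗[k] N →ₗ[k] N) (aRN : N ⊗[k] H →ₗ[k] N) (f : M →ₗ[k] N) : Prop where
  map_actL : f ∘ₗ aLM = aLN ∘ₗ (LinearMap.lTensor H f)
  map_actR : f ∘ₗ aRM = aRN ∘ₗ (LinearMap.rTensor H f)

/-- `f : M → N` is a morphism of `H`-bicomodules. -/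
structure IsBicomoduleHom (cLM : M →ₗ[k] H ⊗[k] M) (cRM : M →ₗ[k] M ⊗[k] H)
    (cLN : N →ₗ[k] H ⊗[k] N) (cRN : N →ₗ[k] N ⊗[k] H) (f : M →ₗ[k] N) : Prop where
  map_coactL : cLN ∘ₗ f = (LinearMap.lTensor H f) ∘ₗ cLM
  map_coactR : cRN ∘ₗ f = (LinearMap.rTensor H f) ∘ₗ cRM

/-- `f : M → N` is a morphism of Hopf bimodules. -/
structure IsHopfBimoduleHom (dM : HopfBimoduleData k H M) (dN : HopfBimoduleData k H N)
    (f : M →ₗ[k] N) : Prop where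
  map_actL : f ∘ₗ dM.actL = dN.actL ∘ₗ (LinearMap.lTensor H f)
  map_actR : f ∘ₗ dM.actR = dN.actR ∘ₗ (LinearMap.rTensor H f)
  map_coactL : dN.coactL ∘ₗ f = (LinearMap.lTensor H f) ∘ₗ dM.coactL
  map_coactR : dN.coactR ∘ₗ f = (LinearMap.rTensor H f) ∘ₗ dM.coactR

theorem IsHopfBimoduleHom.id (dM : HopfBimoduleData k H M) :
    IsHopfBimoduleHom dM dM (LinearMap.id) := by
  constructor <;> simp [LinearMap.lTensor_id, LinearMap.rTensor_id]

theorem IsHopfBimoduleHom.comp {dM : HopfBimoduleData k H M} {dN : HopfBimoduleData k H N}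
    {dP : HopfBimoduleData k H P} {f : M →ₗ[k] N} {g : N →ₗ[k] P}
    (hg : IsHopfBimoduleHom dN dP g) (hf : IsHopfBimoduleHom dM dN f) :
    IsHopfBimoduleHom dM dP (g ∘ₗ f) := by
  constructor
  · rw [LinearMap.comp_assoc, hf.map_actL, ← LinearMap.comp_assoc, hg.map_actL,
      LinearMap.comp_assoc, ← LinearMap.lTensor_comp]
  · rw [LinearMap.comp_assoc, hf.map_actR, ← LinearMap.comp_assoc, hg.map_actR,
      LinearMap.comp_assoc, ← LinearMap.rTensor_comp]
  · rw [← LinearMap.comp_assoc, hg.map_coactL, LinearMap.comp_assoc, hf.map_coactL,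
      ← LinearMap.comp_assoc, ← LinearMap.lTensor_comp]
  · rw [← LinearMap.comp_assoc, hg.map_coactR, LinearMap.comp_assoc, hf.map_coactR,
      ← LinearMap.comp_assoc, ← LinearMap.rTensor_comp]

theorem IsHopfBimoduleHom.zero (dM : HopfBimoduleData k H M) (dN : HopfBimoduleData k H N) :
    IsHopfBimoduleHom dM dN (0 : M →ₗ[k] N) := by
  constructor <;> simp [LinearMap.lTensor_zero, LinearMap.rTensor_zero]

theorem IsHopfBimoduleHom.add {dM : HopfBimoduleData k H M} {dN : HopfBimoduleData k H N}
    {f g : M →ₗ[k] N} (hf : IsHopfBimoduleHom dM dN f) (hg : IsHopfBimoduleHom dM dN g) :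
    IsHopfBimoduleHom dM dN (f + g) := by
  constructor <;>
    simp [LinearMap.lTensor_add, LinearMap.rTensor_add, LinearMap.add_comp, LinearMap.comp_add,
      hf.map_actL, hg.map_actL, hf.map_actR, hg.map_actR, hf.map_coactL, hg.map_coactL,
      hf.map_coactR, hg.map_coactR]

theorem IsHopfBimoduleHom.smul {dM : HopfBimoduleData k H M} {dN : HopfBimoduleData k H N}
    {f : M →ₗ[k] N} (c : k) (hf : IsHopfBimoduleHom dM dN f) :
    IsHopfBimoduleHom dM dN (c • f) := by
  constructor <;>
    simp [LinearMap.lTensor_smul, LinearMap.rTensor_smul, LinearMap.smul_comp, LinearMap.comp_smul,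
      hf.map_actL, hf.map_actR, hf.map_coactL, hf.map_coactR]

/-- The space `Hom_𝓗(M,N)` of morphisms of Hopf bimodules, as a subspace of
the space of `k`-linear maps. -/
noncomputable def homHB (dM : HopfBimoduleData k H M) (dN : HopfBimoduleData k H N) :
    Submodule k (M →ₗ[k] N) where
  carrier := {f | IsHopfBimoduleHom dM dN f}
  add_mem' hf hg := hf.add hg
  zero_mem' := IsHopfBimoduleHom.zero dM dN
  smul_mem' c _ hf := hf.smul c

end Core

section InjChunk

variable {k : Type u} [Field k] {H : Type u} [Ring H] [HopfAlgebra k H]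
variable {M N V I : Type u} [AddCommGroup M] [Module k M] [AddCommGroup N] [Module k N]
  [AddCommGroup V] [Module k V] [AddCommGroup I] [Module k I]

/-- The Hopf bimodule `H ⊗̄ V ⊗̄ H` associated to an `H`-bimodule `(V, aL, aR)`:
underlying space `H ⊗ (V ⊗ H)`, componentwise diagonal actions
`h·(a ⊗ v ⊗ b) = h⁽¹⁾a ⊗ h⁽²⁾v ⊗ h⁽³⁾b`, `(a ⊗ v ⊗ b)·h = ah⁽¹⁾ ⊗ vh⁽²⁾ ⊗ bh⁽³⁾`,
and coactions given by comultiplication on the two outer tensor factors. -/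
noncomputable def HVH (aL : H ⊗[k] V →ₗ[k] V) (aR : V ⊗[k] H →ₗ[k] V) :
    HopfBimoduleData k H (H ⊗[k] (V ⊗[k] H)) where
  actL := diagActL (LinearMap.mul' k H) (diagActL aL (LinearMap.mul' k H))
  actR := diagActR (LinearMap.mul' k H) (diagActR aR (LinearMap.mul' k H))
  coactL := (TensorProduct.assoc k H H (V ⊗[k] H)).toLinearMap ∘ₗ
    LinearMap.rTensor (V ⊗[k] H) (Coalgebra.comul (R := k) (A := H))
  coactR := (TensorProduct.assoc k H (V ⊗[k] H) H).symm.toLinearMap ∘ₗ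
    LinearMap.lTensor H ((TensorProduct.assoc k V H H).symm.toLinearMap ∘ₗ
      LinearMap.lTensor V (Coalgebra.comul (R := k) (A := H)))

/-- An injective object of the category `𝓗` of Hopf bimodules over `H`:
every morphism of Hopf bimodules into `I` extends along every monomorphism. -/
def IsInjectiveHB (dI : HopfBimoduleData k H I) : Prop :=
  ∀ (A B : Type u) (_ : AddCommGroup A) (_ : Module k A) (_ : AddCommGroup B) (_ : Module k B)
    (dA : HopfBimoduleData k H A) (dB : HopfBimoduleData k H B) (f : A →ₗ[k] B),
    IsHopfBimoduleHom dA dB f → Function.Injective f →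
    ∀ g : A →ₗ[k] I, IsHopfBimoduleHom dA dI g →
      ∃ h : B →ₗ[k] I, IsHopfBimoduleHom dB dI h ∧ h ∘ₗ f = g

/-- An injective object of the category of `H`-bimodules. -/
def IsInjectiveBimodule (aL : H ⊗[k] I →ₗ[k] I) (aR : I ⊗[k] H →ₗ[k] I) : Prop :=
  ∀ (A B : Type u) (_ : AddCommGroup A) (_ : Module k A) (_ : AddCommGroup B) (_ : Module k B)
    (aLA : H ⊗[k] A →ₗ[k] A) (aRA : A ⊗[k] H →ₗ[k] A)
    (aLB : H ⊗[k] B →ₗ[k] B) (aRB : B ⊗[k] H →ₗ[k] B) (f : A →ₗ[k] B),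
    IsBimoduleHom aLA aRA aLB aRB f → Function.Injective f →
    ∀ g : A →ₗ[k] I, IsBimoduleHom aLA aRA aL aR g →
      ∃ h : B →ₗ[k] I, IsBimoduleHom aLB aRB aL aR h ∧ h ∘ₗ f = g

/-- A three-term sequence `A → B → C` of Hopf bimodules splits as a sequence of
`H`-bimodules: there are bimodule maps `σ : B → A`, `τ : C → B` with
`f ∘ σ + τ ∘ g = id_B`. -/
def SplitsAsBimodules {A B C : Type u} [AddCommGroup A] [Module k A] [AddCommGroup B]
    [Module k B] [AddCommGroup C] [Module k C]
    (dA : HopfBimoduleData k H A) (dB : HopfBimoduleData k H B) (dC : HopfBimoduleData k H C)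
    (f : A →ₗ[k] B) (g : B →ₗ[k] C) : Prop :=
  ∃ (σ : B →ₗ[k] A) (τ : C →ₗ[k] B),
    IsBimoduleHom dB.actL dB.actR dA.actL dA.actR σ ∧
    IsBimoduleHom dC.actL dC.actR dB.actL dB.actR τ ∧
    f ∘ₗ σ + τ ∘ₗ g = LinearMap.id

/-- A three-term sequence `A → B → C` of Hopf bimodules splits as a sequence of
`H`-bicomodules. -/
def SplitsAsBicomodules {A B C : Type u} [AddCommGroup A] [Module k A] [AddCommGroup B]
    [Module k B] [AddCommGroup C] [Module k C]
    (dA : HopfBimoduleData k H A) (dB : HopfBimoduleData k H B) (dC : HopfBimoduleData k H C)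
    (f : A →ₗ[k] B) (g : B →ₗ[k] C) : Prop :=
  ∃ (σ : B →ₗ[k] A) (τ : C →ₗ[k] B),
    IsBicomoduleHom dB.coactL dB.coactR dA.coactL dA.coactR σ ∧
    IsBicomoduleHom dC.coactL dC.coactR dB.coactL dB.coactR τ ∧
    f ∘ₗ σ + τ ∘ₗ g = LinearMap.id

/-- `I` is a relative injective Hopf bimodule: the functor `Hom_𝓗(−, I)` takes exact
sequences of Hopf bimodules that split as sequences of `H`-bimodules to exact sequences
of `k`-vector spaces. -/
def IsRelativeInjectiveHB (dI : HopfBimoduleData k H I) : Prop :=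
  ∀ (A B C : Type u) (_ : AddCommGroup A) (_ : Module k A) (_ : AddCommGroup B) (_ : Module k B)
    (_ : AddCommGroup C) (_ : Module k C)
    (dA : HopfBimoduleData k H A) (dB : HopfBimoduleData k H B) (dC : HopfBimoduleData k H C)
    (f : A →ₗ[k] B) (g : B →ₗ[k] C)
    (hf : IsHopfBimoduleHom dA dB f) (hg : IsHopfBimoduleHom dB dC g),
    Function.Exact f g → SplitsAsBimodules dA dB dC f g →
    Function.Exact
      (fun ψ : homHB dC dI => (⟨ψ.1 ∘ₗ g, ψ.2.comp hg⟩ : homHB dB dI))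
      (fun ψ : homHB dB dI => (⟨ψ.1 ∘ₗ f, ψ.2.comp hf⟩ : homHB dA dI))

/-- `P` is a relative projective Hopf bimodule: the functor `Hom_𝓗(P, −)` takes exact
sequences of Hopf bimodules that split as sequences of `H`-bicomodules to exact sequences
of `k`-vector spaces. -/
def IsRelativeProjectiveHB {P : Type u} [AddCommGroup P] [Module k P]
    (dP : HopfBimoduleData k H P) : Prop :=
  ∀ (A B C : Type u) (_ : AddCommGroup A) (_ : Module k A) (_ : AddCommGroup B) (_ : Module k B)
    (_ : AddCommGroup C) (_ : Module k C)
    (dA : HopfBimoduleData k H A) (dB : HopfBimoduleData k H B) (dC : HopfBimoduleData k H C)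
    (f : A →ₗ[k] B) (g : B →ₗ[k] C)
    (hf : IsHopfBimoduleHom dA dB f) (hg : IsHopfBimoduleHom dB dC g),
    Function.Exact f g → SplitsAsBicomodules dA dB dC f g →
    Function.Exact
      (fun ψ : homHB dP dA => (⟨f ∘ₗ ψ.1, hf.comp ψ.2⟩ : homHB dP dB))
      (fun ψ : homHB dP dB => (⟨g ∘ₗ ψ.1, hg.comp ψ.2⟩ : homHB dP dC))

end InjChunk

section Statement11

variable {k : Type u} [Field k] {H : Type u} [Ring H] [HopfAlgebra k H]
variable {M I : Type u} [AddCommGroup M] [Module k M] [AddCommGroup I] [Module k I]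

/-- The map `ψ : M → H ⊗̄ I ⊗̄ H`, `ψ(m) = m₍₋₁₎ ⊗ φ(m₍₀₎) ⊗ m₍₁₎`. -/
noncomputable def psiMap (dM : HopfBimoduleData k H M) (φ : M →ₗ[k] I) :
    M →ₗ[k] H ⊗[k] (I ⊗[k] H) :=
  LinearMap.lTensor H (LinearMap.rTensor H φ) ∘ₗ (TensorProduct.assoc k H M H).toLinearMap ∘ₗ
    LinearMap.rTensor H dM.coactL ∘ₗ dM.coactR

/-- The counit-on-the-outer-factors map `ε ⊗ id ⊗ ε : H ⊗ I ⊗ H → I`. -/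
noncomputable def epsOuter : H ⊗[k] (I ⊗[k] H) →ₗ[k] I :=
  (TensorProduct.lid k I).toLinearMap ∘ₗ
    LinearMap.rTensor I (Coalgebra.counit (R := k) (A := H)) ∘ₗ
    LinearMap.lTensor H ((TensorProduct.rid k I).toLinearMap ∘ₗ
      LinearMap.lTensor I (Coalgebra.counit (R := k) (A := H)))

/-- The diagonal left action is natural in both tensor factors. -/
theorem map_comp_diagActL {P Q P' Q' : Type u} [AddCommGroup P] [Module k P]
    [AddCommGroup Q] [Module k Q] [AddCommGroup P'] [Module k P'] [AddCommGroup Q'] [Module k Q']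
    {aP : H ⊗[k] P →ₗ[k] P} {aQ : H ⊗[k] Q →ₗ[k] Q}
    {aP' : H ⊗[k] P' →ₗ[k] P'} {aQ' : H ⊗[k] Q' →ₗ[k] Q'} {f : P →ₗ[k] P'} {g : Q →ₗ[k] Q'}
    (hf : f ∘ₗ aP = aP' ∘ₗ LinearMap.lTensor H f) (hg : g ∘ₗ aQ = aQ' ∘ₗ LinearMap.lTensor H g) :
    TensorProduct.map f g ∘ₗ diagActL aP aQ =
      diagActL aP' aQ' ∘ₗ LinearMap.lTensor H (TensorProduct.map f g) := by
  have hcomm := TensorProduct.tensorTensorTensorComm_comp_map k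
    (LinearMap.id : H →ₗ[k] H) (LinearMap.id : H →ₗ[k] H) f g
  rw [TensorProduct.map_id] at hcomm
  have hcomul : LinearMap.rTensor (P' ⊗[k] Q') (Coalgebra.comul (R := k) (A := H)) ∘ₗ
      LinearMap.lTensor H (TensorProduct.map f g) =
      LinearMap.lTensor (H ⊗[k] H) (TensorProduct.map f g) ∘ₗ
        LinearMap.rTensor (P ⊗[k] Q) (Coalgebra.comul (R := k) (A := H)) := by
    rw [LinearMap.rTensor_comp_lTensor, LinearMap.lTensor_comp_rTensor]
  rw [diagActL, ← LinearMap.comp_assoc, ← TensorProduct.map_comp, hf, hg, TensorProduct.map_comp,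
    diagActL]
  simp only [LinearMap.comp_assoc, hcomul]
  exact congrArg (fun t => TensorProduct.map aP' aQ' ∘ₗ t ∘ₗ
    LinearMap.rTensor (P ⊗[k] Q) (Coalgebra.comul (R := k) (A := H))) hcomm.symm

/-- The diagonal right action is natural in both tensor factors. -/
theorem map_comp_diagActR {P Q P' Q' : Type u} [AddCommGroup P] [Module k P]
    [AddCommGroup Q] [Module k Q] [AddCommGroup P'] [Module k P'] [AddCommGroup Q'] [Module k Q']
    {aP : P ⊗[k] H →ₗ[k] P} {aQ : Q ⊗[k] H →ₗ[k] Q}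
    {aP' : P' ⊗[k] H →ₗ[k] P'} {aQ' : Q' ⊗[k] H →ₗ[k] Q'} {f : P →ₗ[k] P'} {g : Q →ₗ[k] Q'}
    (hf : f ∘ₗ aP = aP' ∘ₗ LinearMap.rTensor H f) (hg : g ∘ₗ aQ = aQ' ∘ₗ LinearMap.rTensor H g) :
    TensorProduct.map f g ∘ₗ diagActR aP aQ =
      diagActR aP' aQ' ∘ₗ LinearMap.rTensor H (TensorProduct.map f g) := by
  have hcomm := TensorProduct.tensorTensorTensorComm_comp_map k
    f g (LinearMap.id : H →ₗ[k] H) (LinearMap.id : H →ₗ[k] H)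
  rw [TensorProduct.map_id] at hcomm
  have hcomul : LinearMap.lTensor (P' ⊗[k] Q') (Coalgebra.comul (R := k) (A := H)) ∘ₗ
      LinearMap.rTensor H (TensorProduct.map f g) =
      LinearMap.rTensor (H ⊗[k] H) (TensorProduct.map f g) ∘ₗ
        LinearMap.lTensor (P ⊗[k] Q) (Coalgebra.comul (R := k) (A := H)) := by
    rw [LinearMap.lTensor_comp_rTensor, LinearMap.rTensor_comp_lTensor]
  rw [diagActR, ← LinearMap.comp_assoc, ← TensorProduct.map_comp, hf, hg, TensorProduct.map_comp,
    diagActR]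
  simp only [LinearMap.comp_assoc, hcomul]
  exact congrArg (fun t => TensorProduct.map aP' aQ' ∘ₗ t ∘ₗ
    LinearMap.lTensor (P ⊗[k] Q) (Coalgebra.comul (R := k) (A := H))) hcomm.symm

/-- If `g` respects the left actions, then so does `m ↦ m₍₋₁₎ ⊗ g(m₍₀₎)`. -/
theorem lTensor_comp_coactL_actL {Q : Type u} [AddCommGroup Q] [Module k Q]
    {dM : HopfBimoduleData k H M} (hM : dM.IsHopfBimodule) {aQ : H ⊗[k] Q →ₗ[k] Q}
    {g : M →ₗ[k] Q} (hg : g ∘ₗ dM.actL = aQ ∘ₗ LinearMap.lTensor H g) :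
    (LinearMap.lTensor H g ∘ₗ dM.coactL) ∘ₗ dM.actL =
      diagActL (LinearMap.mul' k H) aQ ∘ₗ
        LinearMap.lTensor H (LinearMap.lTensor H g ∘ₗ dM.coactL) := by
  have hnat := map_comp_diagActL (aP := LinearMap.mul' k H) (aP' := LinearMap.mul' k H)
    (f := LinearMap.id) (by simp) hg
  rw [LinearMap.comp_assoc, hM.coactL_actL, ← LinearMap.comp_assoc, LinearMap.lTensor_comp,
    ← LinearMap.comp_assoc]
  exact congrArg (· ∘ₗ LinearMap.lTensor H dM.coactL) hnat

/-- If `g` respects the right actions, then so does `m ↦ m₍₋₁₎ ⊗ g(m₍₀₎)`. -/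
theorem lTensor_comp_coactL_actR {Q : Type u} [AddCommGroup Q] [Module k Q]
    {dM : HopfBimoduleData k H M} (hM : dM.IsHopfBimodule) {aQ : Q ⊗[k] H →ₗ[k] Q}
    {g : M →ₗ[k] Q} (hg : g ∘ₗ dM.actR = aQ ∘ₗ LinearMap.rTensor H g) :
    (LinearMap.lTensor H g ∘ₗ dM.coactL) ∘ₗ dM.actR =
      diagActR (LinearMap.mul' k H) aQ ∘ₗ
        LinearMap.rTensor H (LinearMap.lTensor H g ∘ₗ dM.coactL) := by
  have hnat := map_comp_diagActR (aP := LinearMap.mul' k H) (aP' := LinearMap.mul' k H)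
    (f := LinearMap.id) (by simp) hg
  rw [LinearMap.comp_assoc, hM.coactL_actR, ← LinearMap.comp_assoc, LinearMap.rTensor_comp,
    ← LinearMap.comp_assoc]
  exact congrArg (· ∘ₗ LinearMap.rTensor H dM.coactL) hnat

/-- If `f` respects the left actions, then so does `m ↦ f(m₍₀₎) ⊗ m₍₁₎`. -/
theorem rTensor_comp_coactR_actL {dM : HopfBimoduleData k H M} (hM : dM.IsHopfBimodule)
    {aL : H ⊗[k] I →ₗ[k] I} {f : M →ₗ[k] I} (hf : f ∘ₗ dM.actL = aL ∘ₗ LinearMap.lTensor H f) :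
    (LinearMap.rTensor H f ∘ₗ dM.coactR) ∘ₗ dM.actL =
      diagActL aL (LinearMap.mul' k H) ∘ₗ
        LinearMap.lTensor H (LinearMap.rTensor H f ∘ₗ dM.coactR) := by
  have hnat := map_comp_diagActL (aQ := LinearMap.mul' k H) (aQ' := LinearMap.mul' k H)
    (g := LinearMap.id) hf (by simp)
  rw [LinearMap.comp_assoc, hM.coactR_actL, ← LinearMap.comp_assoc, LinearMap.lTensor_comp,
    ← LinearMap.comp_assoc]
  exact congrArg (· ∘ₗ LinearMap.lTensor H dM.coactR) hnat

/-- If `f` respects the right actions, then so does `m ↦ f(m₍₀₎) ⊗ m₍₁₎`. -/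
theorem rTensor_comp_coactR_actR {dM : HopfBimoduleData k H M} (hM : dM.IsHopfBimodule)
    {aR : I ⊗[k] H →ₗ[k] I} {f : M →ₗ[k] I} (hf : f ∘ₗ dM.actR = aR ∘ₗ LinearMap.rTensor H f) :
    (LinearMap.rTensor H f ∘ₗ dM.coactR) ∘ₗ dM.actR =
      diagActR aR (LinearMap.mul' k H) ∘ₗ
        LinearMap.rTensor H (LinearMap.rTensor H f ∘ₗ dM.coactR) := by
  have hnat := map_comp_diagActR (aQ := LinearMap.mul' k H) (aQ' := LinearMap.mul' k H)
    (g := LinearMap.id) hf (by simp)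
  rw [LinearMap.comp_assoc, hM.coactR_actR, ← LinearMap.comp_assoc, LinearMap.rTensor_comp,
    ← LinearMap.comp_assoc]
  exact congrArg (· ∘ₗ LinearMap.rTensor H dM.coactR) hnat

/-- `ψ` may be computed by applying the left coaction first. -/
theorem psiMap_eq_lTensor_comp_coactL {dM : HopfBimoduleData k H M} (hM : dM.IsHopfBimodule)
    (φ : M →ₗ[k] I) :
    psiMap dM φ = LinearMap.lTensor H (LinearMap.rTensor H φ ∘ₗ dM.coactR) ∘ₗ dM.coactL := by
  rw [psiMap, ← hM.bicomodule.bicomod, LinearMap.lTensor_comp, LinearMap.comp_assoc]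

/-- `ψ` in terms of the map `m ↦ m₍₋₁₎ ⊗ φ(m₍₀₎)` applied after the right coaction. -/
theorem psiMap_eq_rTensor_comp_coactR (dM : HopfBimoduleData k H M) (φ : M →ₗ[k] I) :
    psiMap dM φ = (TensorProduct.assoc k H I H).toLinearMap ∘ₗ
      LinearMap.rTensor H (LinearMap.lTensor H φ ∘ₗ dM.coactL) ∘ₗ dM.coactR := by
  have hnat : LinearMap.lTensor H (LinearMap.rTensor H φ) ∘ₗ
      (TensorProduct.assoc k H M H).toLinearMap =
      (TensorProduct.assoc k H I H).toLinearMap ∘ₗ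
        LinearMap.rTensor H (LinearMap.lTensor H φ) :=
    TensorProduct.ext_threefold fun _ _ _ => rfl
  rw [psiMap, ← LinearMap.comp_assoc, hnat, LinearMap.rTensor_comp]
  rfl

theorem psiMap_coactL {dM : HopfBimoduleData k H M} (hM : dM.IsHopfBimodule)
    (aL : H ⊗[k] I →ₗ[k] I) (aR : I ⊗[k] H →ₗ[k] I) (φ : M →ₗ[k] I) :
    (HVH aL aR).coactL ∘ₗ psiMap dM φ = LinearMap.lTensor H (psiMap dM φ) ∘ₗ dM.coactL := by
  rw [psiMap_eq_lTensor_comp_coactL hM]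
  generalize LinearMap.rTensor H φ ∘ₗ dM.coactR = g
  have hassoc : (TensorProduct.assoc k H H (I ⊗[k] H)).toLinearMap ∘ₗ
      LinearMap.lTensor (H ⊗[k] H) g =
      LinearMap.lTensor H (LinearMap.lTensor H g) ∘ₗ
        (TensorProduct.assoc k H H M).toLinearMap :=
    TensorProduct.ext_threefold fun _ _ _ => rfl
  rw [LinearMap.lTensor_comp, LinearMap.comp_assoc, hM.bicomodule.coassocL,
    ← LinearMap.comp_assoc _ _ (LinearMap.lTensor H _), ← hassoc]
  simp only [HVH, LinearMap.comp_assoc]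
  rw [← LinearMap.comp_assoc _ _ (LinearMap.rTensor _ _), LinearMap.rTensor_comp_lTensor,
    ← LinearMap.lTensor_comp_rTensor, LinearMap.comp_assoc]

theorem psiMap_coactR {dM : HopfBimoduleData k H M} (hM : dM.IsHopfBimodule)
    (aL : H ⊗[k] I →ₗ[k] I) (aR : I ⊗[k] H →ₗ[k] I) (φ : M →ₗ[k] I) :
    (HVH aL aR).coactR ∘ₗ psiMap dM φ = LinearMap.rTensor H (psiMap dM φ) ∘ₗ dM.coactR := by
  rw [psiMap_eq_rTensor_comp_coactR]
  generalize LinearMap.lTensor H φ ∘ₗ dM.coactL = f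
  have hcoact : (HVH aL aR).coactR ∘ₗ (TensorProduct.assoc k H I H).toLinearMap =
      LinearMap.rTensor H (TensorProduct.assoc k H I H).toLinearMap ∘ₗ
        (TensorProduct.assoc k (H ⊗[k] I) H H).symm.toLinearMap ∘ₗ
          LinearMap.lTensor (H ⊗[k] I) (Coalgebra.comul (R := k) (A := H)) := by
    refine TensorProduct.ext_threefold fun a v b => ?_
    simp only [HVH, LinearMap.comp_apply, LinearEquiv.coe_coe, TensorProduct.assoc_tmul,
      LinearMap.lTensor_tmul]
    induction Coalgebra.comul (R := k) b with
    | zero => simp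
    | tmul x y => rfl
    | add x y hx hy => simp only [TensorProduct.tmul_add, map_add, hx, hy]
  have hassoc : (TensorProduct.assoc k (H ⊗[k] I) H H).symm.toLinearMap ∘ₗ
      LinearMap.rTensor (H ⊗[k] H) f =
      LinearMap.rTensor H (LinearMap.rTensor H f) ∘ₗ
        (TensorProduct.assoc k M H H).symm.toLinearMap :=
    TensorProduct.ext_threefold' fun _ _ _ => rfl
  rw [LinearMap.rTensor_comp, LinearMap.rTensor_comp, LinearMap.comp_assoc, LinearMap.comp_assoc,
    hM.bicomodule.coassocR,
    ← LinearMap.comp_assoc _ _ (LinearMap.rTensor H (LinearMap.rTensor H f)), ← hassoc, ← LinearMap.comp_assoc, hcoact]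
  simp only [LinearMap.comp_assoc]
  rw [← LinearMap.comp_assoc _ _ (LinearMap.lTensor _ _), LinearMap.lTensor_comp_rTensor,
    ← LinearMap.rTensor_comp_lTensor, LinearMap.comp_assoc]

theorem epsOuter_comp_psiMap {dM : HopfBimoduleData k H M} (hM : dM.IsHopfBimodule)
    (φ : M →ₗ[k] I) : epsOuter ∘ₗ psiMap dM φ = φ := by
  have hrid : (TensorProduct.rid k I).toLinearMap ∘ₗ LinearMap.rTensor k φ =
      φ ∘ₗ (TensorProduct.rid k M).toLinearMap :=
    TensorProduct.ext' fun _ _ => by simp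
  have hlid : (TensorProduct.lid k I).toLinearMap ∘ₗ LinearMap.lTensor k φ =
      φ ∘ₗ (TensorProduct.lid k M).toLinearMap :=
    TensorProduct.ext' fun _ _ => by simp
  have hright : ((TensorProduct.rid k I).toLinearMap ∘ₗ
      LinearMap.lTensor I (Coalgebra.counit (R := k) (A := H))) ∘ₗ
        LinearMap.rTensor H φ ∘ₗ dM.coactR = φ := by
    rw [LinearMap.comp_assoc, ← LinearMap.comp_assoc _ _ (LinearMap.lTensor _ _),
      LinearMap.lTensor_comp_rTensor, ← LinearMap.rTensor_comp_lTensor, LinearMap.comp_assoc,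
      ← LinearMap.comp_assoc, hrid, LinearMap.comp_assoc, hM.bicomodule.counitR,
      LinearMap.comp_id]
  rw [psiMap_eq_lTensor_comp_coactL hM, epsOuter, LinearMap.comp_assoc, LinearMap.comp_assoc,
    ← LinearMap.comp_assoc _ _ (LinearMap.lTensor _ _), ← LinearMap.lTensor_comp, hright,
    ← LinearMap.comp_assoc _ _ (LinearMap.rTensor _ _), LinearMap.rTensor_comp_lTensor,
    ← LinearMap.lTensor_comp_rTensor, LinearMap.comp_assoc, ← LinearMap.comp_assoc, hlid,
    LinearMap.comp_assoc, hM.bicomodule.counitL, LinearMap.comp_id]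

/-- **Statement 11.** Let `M` be a Hopf bimodule over `H`, `I` an `H`-bimodule and
`φ : M → I` an injective morphism of `H`-bimodules. Then
`ψ(m) = m₍₋₁₎ ⊗ φ(m₍₀₎) ⊗ m₍₁₎` is an injective morphism of Hopf bimodules
`M → H ⊗̄ I ⊗̄ H`, and `(ε ⊗ id ⊗ ε) ∘ ψ = φ`. -/
theorem psiMap_injective_hopfBimoduleHom
    (dM : HopfBimoduleData k H M) (hM : dM.IsHopfBimodule)
    (aL : H ⊗[k] I →ₗ[k] I) (aR : I ⊗[k] H →ₗ[k] I) (hbi : IsBimodule aL aR)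
    (φ : M →ₗ[k] I) (hφ : IsBimoduleHom dM.actL dM.actR aL aR φ)
    (hφinj : Function.Injective φ) :
    IsHopfBimoduleHom dM (HVH aL aR) (psiMap dM φ) ∧
    Function.Injective (psiMap dM φ) ∧
    epsOuter ∘ₗ psiMap dM φ = φ := by
  have heps := epsOuter_comp_psiMap hM φ
  refine ⟨⟨?_, ?_, psiMap_coactL hM aL aR φ, psiMap_coactR hM aL aR φ⟩, ?_, heps⟩
  · rw [psiMap_eq_lTensor_comp_coactL hM]
    exact lTensor_comp_coactL_actL hM (rTensor_comp_coactR_actL hM hφ.map_actL)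
  · rw [psiMap_eq_lTensor_comp_coactL hM]
    exact lTensor_comp_coactL_actR hM (rTensor_comp_coactR_actR hM hφ.map_actR)
  · refine Function.Injective.of_comp (f := epsOuter) ?_
    rwa [← LinearMap.coe_comp, heps]

end Statement11
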